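/- Let G be a finite group whose Sylow 2-subgroup is cyclic of order k ≥ 2. Then any product of elements of G equal to the identity must contain an even number of factors whose order is divisible by k. -/

import Mathlib

/-- In a cyclic group of order `2 * m`, the `m`-th power map takes only two values. -/
theorem pow_eq_one_or_eq_of_zpowers {C : Type*} [Group C] {m : ℕ} {c : C}
    (hgen : ∀ x, x ∈ Subgroup.zpowers c) (hc : orderOf c = 2 * m) (x : C) :
    x ^ m = 1 ∨ x ^ m = c ^ m := by
  obtain ⟨i, rfl⟩ := Subgroup.mem_zpowers_iff.mp (hgen x)
  have hsq : (c ^ m) ^ (2 : ℤ) = 1 := by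
    rw [zpow_ofNat, ← pow_mul, mul_comm, ← hc, pow_orderOf_eq_one]
  have hcomm : (c ^ i) ^ m = (c ^ m) ^ i := by
    rw [← zpow_natCast, ← zpow_natCast, ← zpow_mul, ← zpow_mul, mul_comm]
  rw [hcomm]
  obtain ⟨j, rfl⟩ | ⟨j, rfl⟩ := Int.even_or_odd i
  · left
    rw [← two_mul, zpow_mul, hsq, one_zpow]
  · right
    rw [zpow_add, zpow_mul, hsq, one_zpow, one_mul, zpow_one]

/-- A homomorphism preserves divisibility of orders by a number coprime to the order of
its kernel. -/
theorem dvd_orderOf_map_iff {G H : Type*} [Group G] [Group H] (f : G →* H) {k : ℕ}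
    (hk : k.Coprime (Nat.card f.ker)) (g : G) : k ∣ orderOf (f g) ↔ k ∣ orderOf g := by
  refine ⟨fun h => h.trans (orderOf_map_dvd f g), fun h => ?_⟩
  have hmem : g ^ orderOf (f g) ∈ f.ker := by
    rw [MonoidHom.mem_ker, map_pow, pow_orderOf_eq_one]
  have hone : g ^ (orderOf (f g) * Nat.card f.ker) = 1 := by
    rw [pow_mul]
    exact congrArg Subtype.val (pow_card_eq_one' (x := (⟨_, hmem⟩ : f.ker)))
  exact hk.dvd_of_dvd_mul_right (h.trans (orderOf_dvd_of_pow_eq_one hone))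

theorem List.prod_map_eq_pow_countP {α M : Type*} [Monoid M] (s : α → M) (t : M)
    (p : α → Bool) (hs : ∀ a, s a = if p a then t else 1) (l : List α) :
    (l.map s).prod = t ^ l.countP p := by
  induction l with
  | nil => simp
  | cons a l ih =>
    rw [List.map_cons, List.prod_cons, ih, hs, List.countP_cons]
    split_ifs <;> simp [pow_succ']

theorem stmt_19 (G : Type*) [Group G] [Finite G] (k : ℕ) (hk : 2 ≤ k)
    (P : Sylow 2 G) (hcyc : IsCyclic P) (hcard : Nat.card P = k)
    (l : List G) (hprod : l.prod = 1) :
    Even (l.countP (fun g => decide (k ∣ orderOf g))) := by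
  have hkpow : ∃ n, k = 2 ^ (n + 1) := by
    obtain ⟨n, hn⟩ := IsPGroup.iff_card.mp P.isPGroup'
    cases n with
    | zero => exact absurd (hk.trans (hcard.symm.trans hn).le) (by norm_num)
    | succ n => exact ⟨n, hcard.symm.trans hn⟩
  obtain ⟨n, hn⟩ := hkpow
  have hdvd : 2 ∣ Nat.card G := by
    refine dvd_trans ?_ P.card_subgroup_dvd_card
    exact ⟨2 ^ n, by rw [← pow_succ', ← hn]; exact hcard⟩
  have hmin : (Nat.card G).minFac = 2 := (Nat.minFac_eq_two_iff _).mpr hdvd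
  have hnorm : Subgroup.normalizer (P : Set G) ≤ Subgroup.centralizer (P : Set G) :=
    IsCyclic.normalizer_le_centralizer hmin hcyc
  let f : G →* P := MonoidHom.transferSylow P hnorm
  have hcop : k.Coprime (Nat.card f.ker) := by
    rw [hn]
    exact Nat.Coprime.pow_left _ ((Nat.Prime.coprime_iff_not_dvd Nat.prime_two).mpr
      (MonoidHom.not_dvd_card_ker_transferSylow P hnorm))
  obtain ⟨c, hgen⟩ := hcyc.exists_generator
  have hc : orderOf c = 2 * 2 ^ n := by
    rw [orderOf_eq_card_of_forall_mem_zpowers hgen, ← pow_succ', ← hn]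
    exact hcard
  have hone : ∀ x : P, x ^ 2 ^ n = 1 ↔ ¬ k ∣ orderOf x := by
    intro x
    have hx : orderOf x ∣ 2 ^ (n + 1) := by
      rw [← hn, ← hcard]
      exact orderOf_dvd_natCard x
    rw [← orderOf_dvd_iff_pow_eq_one, hn]
    obtain ⟨j, hj, hxj⟩ := (Nat.dvd_prime_pow Nat.prime_two).mp hx
    rw [hxj, Nat.pow_dvd_pow_iff_le_right (by norm_num),
      Nat.pow_dvd_pow_iff_le_right (by norm_num)]
    omega
  have hc_ne : c ^ 2 ^ n ≠ 1 := fun h => (hone c).mp h (by rw [hc, hn, pow_succ'])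
  have horder : orderOf (c ^ 2 ^ n) = 2 := by
    refine orderOf_eq_prime ?_ hc_ne
    rw [← pow_mul, mul_comm, ← hc, pow_orderOf_eq_one]
  let _ : CommGroup P := IsCyclic.commGroup
  let s : G →* P := (powMonoidHom (2 ^ n)).comp f
  have hs : ∀ g, s g = if decide (k ∣ orderOf g) then c ^ 2 ^ n else 1 := by
    intro g
    change f g ^ 2 ^ n = _
    by_cases hg : k ∣ orderOf g
    · have hfg := (dvd_orderOf_map_iff f hcop g).mpr hg
      rw [if_pos (by simpa using hg)]
      exact (pow_eq_one_or_eq_of_zpowers hgen hc (f g)).resolve_left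
        fun h => (hone _).mp h hfg
    · rw [if_neg (by simpa using hg)]
      exact (hone _).mpr fun h => hg ((dvd_orderOf_map_iff f hcop g).mp h)
  have hpow := List.prod_map_eq_pow_countP s _ _ hs l
  rw [← map_list_prod, hprod, map_one] at hpow
  rw [even_iff_two_dvd, ← horder]
  exact orderOf_dvd_of_pow_eq_one hpow.symm
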